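/- Let (R,Δ,ε,1,▹) be a cocommutative rack bialgebra over K, let μⁿ : R^⊗n → R be the iterated products and Cⁿ(R;R) the K-module of coderivations along μⁿ. For ω ∈ Cⁿ(R;R) define d_{i,1}ω(r₁,…,r_{n+1}) = Σ μ^i(r₁⁽¹⁾,…,r_{i−1}⁽¹⁾,r_i)▹ω(r₁⁽²⁾,…,r_{i−1}⁽²⁾,r_{i+1},…,r_{n+1}), d_{i,0}ω(r₁,…,r_{n+1}) = Σ ω(r₁,…,r_{i−1}, r_i⁽¹⁾▹r_{i+1}, …, r_i⁽ⁿ⁺¹⁻ⁱ⁾▹r_{n+1}) for 1 ≤ i ≤ n, and d_{n+1}ω(r₁,…,r_{n+1}) = Σ ω(r₁⁽¹⁾,…,r_{n−1}⁽¹⁾,rₙ)▹μⁿ(r₁⁽²⁾,…,r_{n−1}⁽²⁾,r_{n+1}), and set d_Rⁿ := Σ_{i=1}^{n} (−1)^{i+1}(d_{i,1} − d_{i,0}) + (−1)^{n+1} d_{n+1}. Then each of the maps d_{i,1}, d_{i,0}, d_{n+1} sends Cⁿ(R;R) into Cⁿ⁺¹(R;R), and d_R^{n+1}∘d_Rⁿ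 = 0; hence (C*(R;R), d_R) is a cochain complex. -/

import Mathlib

open TensorProduct

namespace RackPaper

variable (K : Type*) [CommRing K]
variable (B : Type*) [AddCommGroup B] [Module K B]

/-- Comultiplication of the tensor-product coalgebra `B ⊗ B`. -/
noncomputable def comul2 (comul : B →ₗ[K] B ⊗[K] B) :
    B ⊗[K] B →ₗ[K] (B ⊗[K] B) ⊗[K] (B ⊗[K] B) :=
  (tensorTensorTensorComm K B B B B).toLinearMap ∘ₗ TensorProduct.map comul comul

/-- Counit of the tensor-product coalgebra `B ⊗ B`. -/
noncomputable def counit2 (counit : B →ₗ[K] K) : B ⊗[K] B →ₗ[K] K :=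
  (LinearMap.mul' K K) ∘ₗ TensorProduct.map counit counit

/-- `(B, comul, counit, one)` is a coassociative counital coaugmented coalgebra. -/
structure IsC3Coalgebra (comul : B →ₗ[K] B ⊗[K] B) (counit : B →ₗ[K] K) (one : B) : Prop where
  coassoc : (TensorProduct.assoc K B B B).toLinearMap ∘ₗ
      (TensorProduct.map comul LinearMap.id) ∘ₗ comul
      = (TensorProduct.map LinearMap.id comul) ∘ₗ comul
  counit_comul : (TensorProduct.lid K B).toLinearMap ∘ₗ
      (TensorProduct.map counit LinearMap.id) ∘ₗ comul = LinearMap.id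
  comul_counit : (TensorProduct.rid K B).toLinearMap ∘ₗ
      (TensorProduct.map LinearMap.id counit) ∘ₗ comul = LinearMap.id
  comul_one : comul one = one ⊗ₜ[K] one
  counit_one : counit one = 1

/-- A rack bialgebra structure on the C³-coalgebra `(B, comul, counit, one)`:
the multiplication `μ` (written `a ▹ b`) is a morphism of C³-coalgebras,
`1 ▹ a = a`, `a ▹ 1 = ε(a) 1`, and the self-distributivity identity
`a ▹ (b ▹ c) = Σ (a⁽¹⁾ ▹ b) ▹ (a⁽²⁾ ▹ c)` holds. -/
structure IsRackBialgebra (comul : B →ₗ[K] B ⊗[K] B) (counit : B →ₗ[K] K) (one : B)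
    (mul : B ⊗[K] B →ₗ[K] B) : Prop where
  isC3 : IsC3Coalgebra K B comul counit one
  comul_mul : comul ∘ₗ mul = (TensorProduct.map mul mul) ∘ₗ comul2 K B comul
  counit_mul : counit ∘ₗ mul = counit2 K B counit
  one_mul : ∀ a : B, mul (one ⊗ₜ[K] a) = a
  mul_one : ∀ a : B, mul (a ⊗ₜ[K] one) = counit a • one
  self_distrib : mul ∘ₗ TensorProduct.map LinearMap.id mul
      = mul ∘ₗ TensorProduct.map mul mul ∘ₗ
          (tensorTensorTensorComm K B B B B).toLinearMap ∘ₗ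
          TensorProduct.map comul LinearMap.id

/-- An element `x` is primitive: `Δ(x) = x ⊗ 1 + 1 ⊗ x`. -/
def IsPrimitive (comul : B →ₗ[K] B ⊗[K] B) (one : B) (x : B) : Prop :=
  comul x = x ⊗ₜ[K] one + one ⊗ₜ[K] x

section TensorPowers

variable (R : Type*) [AddCommGroup R] [Module K R]

/-- Iterated tensor power as a bundled module: `TpowM n` represents `R^{⊗(n+1)}`
(right-nested). -/
noncomputable def TpowM : ℕ → ModuleCat K
  | 0 => ModuleCat.of K R
  | n + 1 => ModuleCat.of K (R ⊗[K] (TpowM n))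

/-- The underlying type of the iterated tensor power `R^{⊗(n+1)}`. -/
noncomputable abbrev Tpow (n : ℕ) : Type _ := (TpowM K R n : Type _)

/-- Transport along an equality of indices. -/
noncomputable def tcast {m m' : ℕ} (h : m = m') : Tpow K R m →ₗ[K] Tpow K R m' := by
  subst h; exact LinearMap.id

/-- `μⁿ⁺¹ : R^{⊗(n+1)} → R`, the iterated rack product
`r₀ ⊗ ⋯ ⊗ rₙ ↦ r₀ ▹ (r₁ ▹ ( ⋯ ▹ rₙ))`. -/
noncomputable def muL (mul : R ⊗[K] R →ₗ[K] R) : (n : ℕ) → Tpow K R n →ₗ[K] R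
  | 0 => LinearMap.id
  | n + 1 => mul ∘ₗ (TensorProduct.map LinearMap.id (muL mul n))

/-- The comultiplication of the tensor-product coalgebra `R^{⊗(n+1)}`. -/
noncomputable def deltaL (comul : R →ₗ[K] R ⊗[K] R) :
    (n : ℕ) → Tpow K R n →ₗ[K] Tpow K R n ⊗[K] Tpow K R n
  | 0 => comul
  | n + 1 =>
    (tensorTensorTensorComm K R R (Tpow K R n) (Tpow K R n)).toLinearMap ∘ₗ
      TensorProduct.map comul (deltaL comul n)

/-- The counit of the tensor-product coalgebra `R^{⊗(n+1)}`. -/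
noncomputable def epsL (counit : R →ₗ[K] K) : (n : ℕ) → Tpow K R n →ₗ[K] K
  | 0 => counit
  | n + 1 => LinearMap.mul' K K ∘ₗ TensorProduct.map counit (epsL counit n)

/-- The "Sweedler split" map
`r₁ ⊗ ⋯ ⊗ r_{j+s+2} ↦ Σ (r₁⁽¹⁾ ⊗ ⋯ ⊗ r_j⁽¹⁾ ⊗ r_{j+1}) ⊗ (r₁⁽²⁾ ⊗ ⋯ ⊗ r_j⁽²⁾ ⊗ r_{j+2} ⊗ ⋯)`,
comultiplying the first `j` factors jointly and splitting. -/
noncomputable def Dsplit (comul : R →ₗ[K] R ⊗[K] R) :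
    (s j : ℕ) → Tpow K R ((s + 1) + j) →ₗ[K] Tpow K R j ⊗[K] Tpow K R (s + j)
  | _, 0 => LinearMap.id
  | s, j + 1 =>
    (tensorTensorTensorComm K R R (Tpow K R j) (Tpow K R (s + j))).toLinearMap ∘ₗ
      TensorProduct.map comul (Dsplit comul s j)

/-- `a ⊗ (b₀ ⊗ ⋯ ⊗ b_p) ↦ Σ (a⁽¹⁾ ▹ b₀) ⊗ ⋯ ⊗ (a⁽ᵖ⁺¹⁾ ▹ b_p)`. -/
noncomputable def Amap (comul : R →ₗ[K] R ⊗[K] R) (mul : R ⊗[K] R →ₗ[K] R) :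
    (p : ℕ) → R ⊗[K] Tpow K R p →ₗ[K] Tpow K R p
  | 0 => mul
  | p + 1 =>
    TensorProduct.map mul (Amap comul mul p) ∘ₗ
      (tensorTensorTensorComm K R R R (Tpow K R p)).toLinearMap ∘ₗ
      TensorProduct.map comul LinearMap.id

/-- `r₁ ⊗ ⋯ ⊗ r_j ⊗ a ⊗ b₀ ⊗ ⋯ ⊗ b_p ↦ Σ r₁ ⊗ ⋯ ⊗ r_j ⊗ (a⁽¹⁾ ▹ b₀) ⊗ ⋯ ⊗ (a⁽ᵖ⁺¹⁾ ▹ b_p)`: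
the first `j` factors are untouched, the next one is comultiplied `p+1` times and acts on the
remaining factors. -/
noncomputable def Gmap (comul : R →ₗ[K] R ⊗[K] R) (mul : R ⊗[K] R →ₗ[K] R) :
    (p j : ℕ) → Tpow K R ((p + 1) + j) →ₗ[K] Tpow K R (p + j)
  | p, 0 => Amap K R comul mul p
  | p, j + 1 => TensorProduct.map LinearMap.id (Gmap comul mul p j)

end TensorPowers

section DeformationComplex

variable (R : Type*) [AddCommGroup R] [Module K R]
variable (comul : R →ₗ[K] R ⊗[K] R) (counit : R →ₗ[K] K) (mul : R ⊗[K] R →ₗ[K] R)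

/-- `ω : R^{⊗(n+1)} → R` is a coderivation along `μⁿ⁺¹`:
`Δ ∘ ω = (ω ⊗ μⁿ⁺¹ + μⁿ⁺¹ ⊗ ω) ∘ Δ_{R^{⊗(n+1)}}`. -/
def IsCoderivation (n : ℕ) (ω : Tpow K R n →ₗ[K] R) : Prop :=
  comul ∘ₗ ω = (TensorProduct.map ω (muL K R mul n)
    + TensorProduct.map (muL K R mul n) ω) ∘ₗ deltaL K R comul n

/-- The face map `d_{i,1}` (with `i = j+1`) of the deformation complex:
`(d_{i,1}ω)(r₁,…,r_{n+1}) = Σ μ^i(r₁⁽¹⁾,…,r_{i-1}⁽¹⁾,r_i) ▹ ω(r₁⁽²⁾,…,r_{i-1}⁽²⁾,r_{i+1},…,r_{n+1})`. -/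
noncomputable def dOne (m j : ℕ) (hj : j ≤ m) (ω : Tpow K R m →ₗ[K] R) :
    Tpow K R (m + 1) →ₗ[K] R :=
  mul ∘ₗ TensorProduct.map (muL K R mul j) (ω ∘ₗ tcast K R (show (m - j) + j = m by omega)) ∘ₗ
    Dsplit K R comul (m - j) j ∘ₗ tcast K R (show m + 1 = ((m - j) + 1) + j by omega)

/-- The face map `d_{i,0}` (with `i = j+1`) of the deformation complex:
`(d_{i,0}ω)(r₁,…,r_{n+1}) = Σ ω(r₁,…,r_{i-1}, r_i⁽¹⁾ ▹ r_{i+1}, …, r_i⁽ⁿ⁺¹⁻ⁱ⁾ ▹ r_{n+1})`. -/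
noncomputable def dZero (m j : ℕ) (hj : j ≤ m) (ω : Tpow K R m →ₗ[K] R) :
    Tpow K R (m + 1) →ₗ[K] R :=
  ω ∘ₗ tcast K R (show (m - j) + j = m by omega) ∘ₗ Gmap K R comul mul (m - j) j ∘ₗ
    tcast K R (show m + 1 = ((m - j) + 1) + j by omega)

/-- The extra face map `d_{n+1}` of the deformation complex:
`(d_{n+1}ω)(r₁,…,r_{n+1}) = Σ ω(r₁⁽¹⁾,…,r_{n-1}⁽¹⁾,rₙ) ▹ μⁿ(r₁⁽²⁾,…,r_{n-1}⁽²⁾,r_{n+1})`. -/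
noncomputable def dLast (m : ℕ) (ω : Tpow K R m →ₗ[K] R) : Tpow K R (m + 1) →ₗ[K] R :=
  mul ∘ₗ TensorProduct.map ω (muL K R mul m ∘ₗ tcast K R (show 0 + m = m by omega)) ∘ₗ
    Dsplit K R comul 0 m ∘ₗ tcast K R (show m + 1 = (0 + 1) + m by omega)

/-- The differential `d_Rⁿ = Σ_{i=1}^{n} (−1)^{i+1}(d_{i,1} − d_{i,0}) + (−1)^{n+1} d_{n+1}`
of the deformation complex (on `(m+1)`-cochains, i.e. `n = m+1`). -/
noncomputable def dDef (m : ℕ) (ω : Tpow K R m →ₗ[K] R) : Tpow K R (m + 1) →ₗ[K] R :=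
  (∑ j : Fin (m + 1), ((-1 : K) ^ (j : ℕ)) •
      (dOne K R comul mul m j (Nat.lt_succ_iff.mp j.isLt) ω
        - dZero K R comul mul m j (Nat.lt_succ_iff.mp j.isLt) ω))
  + ((-1 : K) ^ (m + 2)) • dLast K R comul mul m ω

end DeformationComplex

section ShelfSequences

variable {X : Type*} [Shelf X]

open scoped Quandles

/-- The iterated product `f 0 ◃ (f 1 ◃ (⋯ ◃ f n))` in a shelf. -/
def shelfProd : ℕ → (ℕ → X) → X
  | 0, f => f 0
  | n + 1, f => f 0 ◃ shelfProd n fun i => f (i + 1)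

/-- Delete the `j`-th entry of a sequence. -/
def skip {X : Type*} (j : ℕ) (f : ℕ → X) : ℕ → X := fun i => if i < j then f i else f (i + 1)

/-- Delete the `j`-th entry of a sequence and let it act on all later entries. -/
def actTail (j : ℕ) (f : ℕ → X) : ℕ → X := fun i => if i < j then f i else f j ◃ f (i + 1)

lemma shelfProd_congr {n : ℕ} {f g : ℕ → X} (h : ∀ i ≤ n, f i = g i) :
    shelfProd n f = shelfProd n g := by
  induction n generalizing f g with
  | zero => exact h 0 le_rfl
  | succ n ih =>
    simp only [shelfProd]
    rw [h 0 (by omega), ih fun i hi => h (i + 1) (by omega)]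

lemma skip_succ_tail {X : Type*} (j : ℕ) (f : ℕ → X) :
    (fun i => skip (j + 1) f (i + 1)) = skip j fun i => f (i + 1) := by
  funext i; simp [skip]

lemma actTail_succ_tail (j : ℕ) (f : ℕ → X) :
    (fun i => actTail (j + 1) f (i + 1)) = actTail j fun i => f (i + 1) := by
  funext i; simp [actTail]

lemma act_shelfProd (n : ℕ) (x : X) (f : ℕ → X) :
    shelfProd n (fun i => x ◃ f i) = x ◃ shelfProd n f := by
  induction n generalizing f with
  | zero => rfl
  | succ n ih => simp only [shelfProd, ih, ← Shelf.self_distrib]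

lemma shelfProd_act_skip {j m : ℕ} (h : j ≤ m) (f : ℕ → X) :
    shelfProd j f ◃ shelfProd m (skip j f) = shelfProd (m + 1) f := by
  induction j generalizing m f with
  | zero => rfl
  | succ j ih =>
    obtain ⟨m, rfl⟩ : ∃ k, m = k + 1 := ⟨m - 1, by omega⟩
    rw [shelfProd, shelfProd, skip_succ_tail, show skip (j + 1) f 0 = f 0 by simp [skip],
      ← Shelf.self_distrib, ih (by omega), ← shelfProd]

lemma shelfProd_actTail {j m : ℕ} (h : j ≤ m) (f : ℕ → X) :
    shelfProd m (actTail j f) = shelfProd (m + 1) f := by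
  induction j generalizing m f with
  | zero => exact act_shelfProd m (f 0) fun i => f (i + 1)
  | succ j ih =>
    obtain ⟨m, rfl⟩ : ∃ k, m = k + 1 := ⟨m - 1, by omega⟩
    rw [shelfProd, actTail_succ_tail, show actTail (j + 1) f 0 = f 0 by simp [actTail],
      ih (by omega), ← shelfProd]

lemma shelfProd_skip_of_lt {j m : ℕ} (h : m < j) (f : ℕ → X) :
    shelfProd m (skip j f) = shelfProd m f :=
  shelfProd_congr fun i hi => by simp [skip, show i < j by omega]

lemma skip_skip {X : Type*} {i j : ℕ} (h : i ≤ j) (f : ℕ → X) :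
    skip i (skip (j + 1) f) = skip j (skip i f) := by
  funext k; simp only [skip]; grind

lemma actTail_skip {i j : ℕ} (h : i ≤ j) (f : ℕ → X) :
    actTail i (skip (j + 1) f) = skip j (actTail i f) := by
  funext k; simp only [skip, actTail]; grind

lemma skip_actTail {i j : ℕ} (h : i ≤ j) (f : ℕ → X) :
    skip i (actTail (j + 1) f) = actTail j (skip i f) := by
  funext k; simp only [skip, actTail]; grind

lemma actTail_actTail {i j : ℕ} (h : i ≤ j) (f : ℕ → X) :
    actTail i (actTail (j + 1) f) = actTail j (actTail i f) := by
  funext k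
  simp only [actTail]
  have := @Shelf.self_distrib X _ (f i) (f (j + 1)) (f (k + 1 + 1))
  grind

end ShelfSequences

section ShelfModule

open scoped Quandles

variable {K}
variable {X : Type*} [Shelf X] {A : Type*} [AddCommGroup A] [Module K A]

/-- Left and right actions of a shelf `X` on a module `A`, together with a family of elements
of `A` tangent to the points of `X`, on which the actions satisfy the linearisation of
self-distributivity in each of the three arguments. -/
structure IsShelfModule (lact ract : X → A →ₗ[K] A) (tangent : X → A → Prop) : Prop where
  lact_lact : ∀ x y a, lact x (lact y a) = lact (x ◃ y) (lact x a)
  lact_ract : ∀ x y a, lact x (ract y a) = ract (x ◃ y) (lact x a)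
  ract_act : ∀ p x y a, tangent p a →
    ract (x ◃ y) a = ract (p ◃ y) (ract x a) + lact (p ◃ x) (ract y a)

/-- The face `ω ↦ (f ↦ (f 0 ◃ ⋯ ◃ f j) ▹ ω (f 0, …, f (j-1), f (j+1), …))`. -/
def faceOne (lact : X → A →ₗ[K] A) (j : ℕ) : ((ℕ → X) → A) →ₗ[K] ((ℕ → X) → A) where
  toFun ω f := lact (shelfProd j f) (ω (skip j f))
  map_add' _ _ := by ext; simp
  map_smul' _ _ := by ext; simp

variable (K A) in
/-- The face `ω ↦ (f ↦ ω (f 0, …, f (j-1), f j ◃ f (j+1), f j ◃ f (j+2), …))`. -/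
def faceZero (j : ℕ) : ((ℕ → X) → A) →ₗ[K] ((ℕ → X) → A) where
  toFun ω f := ω (actTail j f)
  map_add' _ _ := rfl
  map_smul' _ _ := rfl

/-- The face `ω ↦ (f ↦ ω (f 0, …, f m) ▹ (f 0 ◃ ⋯ ◃ f (m-1) ◃ f (m+1)))`. -/
def faceLast (ract : X → A →ₗ[K] A) (m : ℕ) : ((ℕ → X) → A) →ₗ[K] ((ℕ → X) → A) where
  toFun ω f := ract (shelfProd m (skip m f)) (ω f)
  map_add' _ _ := by ext; simp
  map_smul' _ _ := by ext; simp

/-- The difference of the two cubical faces of index `j`. -/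
def faceDiff (lact : X → A →ₗ[K] A) (j : ℕ) : ((ℕ → X) → A) →ₗ[K] ((ℕ → X) → A) :=
  faceOne lact j - faceZero K A j

/-- The differential of the complex of a shelf with coefficients in a shelf module. -/
def shelfDiff (lact ract : X → A →ₗ[K] A) (m : ℕ) : ((ℕ → X) → A) →ₗ[K] ((ℕ → X) → A) :=
  ∑ j ∈ Finset.range (m + 1), (-1 : K) ^ j • faceDiff lact j
    + (-1 : K) ^ (m + 2) • faceLast ract m

lemma alternating_sum_eq_zero {M : Type*} [AddCommGroup M] [Module K M] (g : ℕ → ℕ → M) (m : ℕ)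
    (h : ∀ i j, i ≤ j → j ≤ m → g (j + 1) i = g i j) :
    ∑ i ∈ Finset.range (m + 1), ∑ j ∈ Finset.range (m + 2), (-1 : K) ^ (i + j) • g j i = 0 := by
  induction m with
  | zero => simp [Finset.sum_range_succ, h 0 0 le_rfl le_rfl]
  | succ m ih =>
    have key : ∑ i ∈ Finset.range (m + 2), ((-1 : K) ^ (i + (m + 2)) • g (m + 2) i
        + (-1 : K) ^ (m + 1 + i) • g i (m + 1)) = 0 := by
      refine Finset.sum_eq_zero fun i hi => ?_
      rw [h i (m + 1) (by simp at hi; omega) le_rfl, ← add_smul]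
      convert zero_smul K _ using 2
      ring
    specialize ih fun i j hi hj => h i j hi (by omega)
    rw [Finset.sum_add_distrib, Finset.sum_range_succ _ (m + 1)] at key
    rw [Finset.sum_range_succ]
    simp only [Finset.sum_range_succ _ (m + 2), Finset.sum_add_distrib]
    rw [ih, zero_add, ← key]
    abel

section Faces

variable {lact ract : X → A →ₗ[K] A} {tangent : X → A → Prop}

lemma faceDiff_comm (hA : IsShelfModule lact ract tangent) {i j : ℕ} (h : i ≤ j)
    (ω : (ℕ → X) → A) :
    faceDiff lact (j + 1) (faceDiff lact i ω) = faceDiff lact i (faceDiff lact j ω) := by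
  have h11 : faceOne lact (j + 1) (faceOne lact i ω) = faceOne lact i (faceOne lact j ω) := by
    funext f
    simp only [faceOne, LinearMap.coe_mk, AddHom.coe_mk]
    rw [hA.lact_lact (shelfProd i f), shelfProd_act_skip h, skip_skip h,
      shelfProd_skip_of_lt (by omega)]
  have h10 : faceOne lact (j + 1) (faceZero K A i ω) = faceZero K A i (faceOne lact j ω) := by
    funext f
    simp only [faceOne, faceZero, LinearMap.coe_mk, AddHom.coe_mk]
    rw [actTail_skip h, shelfProd_actTail h]
  have h01 : faceZero K A (j + 1) (faceOne lact i ω) = faceOne lact i (faceZero K A j ω) := by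
    funext f
    simp only [faceOne, faceZero, LinearMap.coe_mk, AddHom.coe_mk]
    rw [skip_actTail h]
    congr 2
    exact shelfProd_congr fun k hk => by simp [actTail, show k < j + 1 by omega]
  have h00 : faceZero K A (j + 1) (faceZero K A i ω) = faceZero K A i (faceZero K A j ω) := by
    funext f
    simp only [faceZero, LinearMap.coe_mk, AddHom.coe_mk]
    rw [actTail_actTail h]
  simp only [faceDiff, LinearMap.sub_apply, map_sub, h11, h10, h01, h00]
  abel

lemma faceDiff_faceLast (hA : IsShelfModule lact ract tangent) {j m : ℕ} (h : j ≤ m)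
    (ω : (ℕ → X) → A) :
    faceDiff lact j (faceLast ract m ω) = faceLast ract (m + 1) (faceDiff lact j ω) := by
  rw [faceDiff, LinearMap.sub_apply, LinearMap.sub_apply, map_sub]
  congr 1
  · funext f
    simp only [faceOne, faceLast, LinearMap.coe_mk, AddHom.coe_mk]
    rw [hA.lact_ract, ← skip_skip h, ← shelfProd_skip_of_lt (show j < m + 1 by omega) f,
      shelfProd_act_skip h]
  · funext f
    simp only [faceZero, faceLast, LinearMap.coe_mk, AddHom.coe_mk]
    rw [← actTail_skip h, shelfProd_actTail h]

lemma faceDiff_succ_faceLast (hA : IsShelfModule lact ract tangent) {m : ℕ} {ω : (ℕ → X) → A}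
    (hω : ∀ f, tangent (shelfProd m f) (ω f)) (hloc : ∀ f g, (∀ i ≤ m, f i = g i) → ω f = ω g) :
    faceDiff lact (m + 1) (faceLast ract m ω) + faceLast ract (m + 1) (faceLast ract m ω) = 0 := by
  funext f
  simp only [faceDiff, faceOne, faceZero, faceLast, LinearMap.coe_mk, AddHom.coe_mk,
    LinearMap.sub_apply, Pi.add_apply, Pi.sub_apply, Pi.zero_apply]
  have hskip : ω (skip (m + 1) f) = ω f :=
    hloc _ _ fun i hi => by simp [skip, show i < m + 1 by omega]
  have hact : ω (actTail (m + 1) f) = ω f :=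
    hloc _ _ fun i hi => by simp [actTail, show i < m + 1 by omega]
  have hlast : shelfProd m (skip m (actTail (m + 1) f))
      = shelfProd m (skip m f) ◃ shelfProd m (skip m (skip m f)) := by
    rw [skip_actTail le_rfl, shelfProd_actTail le_rfl, shelfProd_act_skip le_rfl]
  rw [hskip, hact, hlast, hA.ract_act _ _ _ _ (hω f), shelfProd_act_skip le_rfl,
    ← skip_skip le_rfl, ← shelfProd_skip_of_lt (show m < m + 1 by omega) f,
    shelfProd_act_skip le_rfl]
  abel

theorem shelfDiff_shelfDiff (hA : IsShelfModule lact ract tangent) {m : ℕ} {ω : (ℕ → X) → A}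
    (hω : ∀ f, tangent (shelfProd m f) (ω f)) (hloc : ∀ f g, (∀ i ≤ m, f i = g i) → ω f = ω g) :
    shelfDiff lact ract (m + 1) (shelfDiff lact ract m ω) = 0 := by
  have hcube := alternating_sum_eq_zero (K := K)
    (fun j i => faceDiff lact j (faceDiff lact i ω)) m fun i j hij _ => faceDiff_comm hA hij ω
  have hsucc := faceDiff_succ_faceLast hA hω hloc
  have hmix : ∑ j ∈ Finset.range (m + 1),
      ((-1 : K) ^ (m + 2) • (-1 : K) ^ j • faceDiff lact j (faceLast ract m ω)
        + (-1 : K) ^ j • (-1 : K) ^ (m + 1 + 2) • faceLast ract (m + 1) (faceDiff lact j ω)) = 0 := by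
    refine Finset.sum_eq_zero fun j hj => ?_
    rw [faceDiff_faceLast hA (by simp at hj; omega), smul_smul, smul_smul, ← add_smul]
    convert zero_smul K _ using 2
    ring
  rw [Finset.sum_add_distrib] at hmix
  simp only [shelfDiff, LinearMap.add_apply, LinearMap.sum_apply, LinearMap.smul_apply, map_add,
    map_sum, map_smul, smul_add, Finset.smul_sum, Finset.sum_add_distrib, smul_smul,
    ← pow_add] at hcube hmix ⊢
  rw [Finset.sum_range_succ _ (m + 1)]
  linear_combination (norm := module)
    hcube + hmix + (-1 : K) ^ (m + 2 + (m + 1)) • hsucc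

end Faces

end ShelfModule

section Convolution

open scoped Quandles

variable {K}
variable {C : Type*} [AddCommGroup C] [Module K C] [Coalgebra K C]
variable {M N P Q M' N' : Type*} [AddCommGroup M] [Module K M] [AddCommGroup N] [Module K N]
  [AddCommGroup P] [Module K P] [AddCommGroup Q] [Module K Q]
  [AddCommGroup M'] [Module K M'] [AddCommGroup N'] [Module K N']

/-- The map `c ↦ Σ f(c⁽¹⁾) ⊗ g(c⁽²⁾)`. -/
noncomputable def convPair (f : C →ₗ[K] M) (g : C →ₗ[K] N) : C →ₗ[K] M ⊗[K] N :=
  TensorProduct.map f g ∘ₗ Coalgebra.comul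

lemma map_comp_convPair (a : M →ₗ[K] M') (b : N →ₗ[K] N') (f : C →ₗ[K] M) (g : C →ₗ[K] N) :
    TensorProduct.map a b ∘ₗ convPair f g = convPair (a ∘ₗ f) (b ∘ₗ g) := by
  rw [convPair, convPair, TensorProduct.map_comp, LinearMap.comp_assoc]

lemma convPair_add_left (f f' : C →ₗ[K] M) (g : C →ₗ[K] N) :
    convPair (f + f') g = convPair f g + convPair f' g := by
  rw [convPair, TensorProduct.map_add_left, LinearMap.add_comp]; rfl

lemma convPair_add_right (f : C →ₗ[K] M) (g g' : C →ₗ[K] N) :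
    convPair f (g + g') = convPair f g + convPair f g' := by
  rw [convPair, TensorProduct.map_add_right, LinearMap.add_comp]; rfl

lemma convPair_smul_left (k : K) (f : C →ₗ[K] M) (g : C →ₗ[K] N) :
    convPair (k • f) g = k • convPair f g := by
  rw [convPair, TensorProduct.map_smul_left, LinearMap.smul_comp]; rfl

lemma convPair_smul_right (k : K) (f : C →ₗ[K] M) (g : C →ₗ[K] N) :
    convPair f (k • g) = k • convPair f g := by
  rw [convPair, TensorProduct.map_smul_right, LinearMap.smul_comp]; rfl

lemma tensorTensorTensorComm_convPair [Coalgebra.IsCocomm K C] (f : C →ₗ[K] M) (g : C →ₗ[K] N)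
    (h : C →ₗ[K] P) (k : C →ₗ[K] Q) :
    (tensorTensorTensorComm K M N P Q).toLinearMap ∘ₗ convPair (convPair f g) (convPair h k)
      = convPair (convPair f h) (convPair g k) := by
  have hδ : (tensorTensorTensorComm K C C C C).toLinearMap ∘ₗ
      TensorProduct.map Coalgebra.comul Coalgebra.comul ∘ₗ Coalgebra.comul
      = TensorProduct.map Coalgebra.comul Coalgebra.comul ∘ₗ Coalgebra.comul :=
    (Coalgebra.comulCoalgHom K C).map_comp_comul.symm
  have hnat : (tensorTensorTensorComm K M N P Q).toLinearMap ∘ₗ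
      TensorProduct.map (TensorProduct.map f g) (TensorProduct.map h k)
      = TensorProduct.map (TensorProduct.map f h) (TensorProduct.map g k) ∘ₗ
        (tensorTensorTensorComm K C C C C).toLinearMap := by
    ext; simp
  simp only [convPair, TensorProduct.map_comp]
  rw [LinearMap.comp_assoc, ← LinearMap.comp_assoc, hnat, LinearMap.comp_assoc, hδ,
    LinearMap.comp_assoc]

lemma shuffle_convPair [Coalgebra.IsCocomm K C] {a : M' →ₗ[K] M ⊗[K] N}
    {b : N' →ₗ[K] P ⊗[K] Q} {f : C →ₗ[K] M'} {g : C →ₗ[K] N'}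
    {f₁ : C →ₗ[K] M} {f₂ : C →ₗ[K] N} {g₁ : C →ₗ[K] P} {g₂ : C →ₗ[K] Q}
    (hf : a ∘ₗ f = convPair f₁ f₂) (hg : b ∘ₗ g = convPair g₁ g₂) :
    ((tensorTensorTensorComm K M N P Q).toLinearMap ∘ₗ TensorProduct.map a b) ∘ₗ convPair f g
      = convPair (convPair f₁ g₁) (convPair f₂ g₂) := by
  rw [LinearMap.comp_assoc, map_comp_convPair, hf, hg, tensorTensorTensorComm_convPair]

variable {R : Type*} [AddCommGroup R] [Module K R]

variable (C) in
/-- The linear maps `C → R` compatible with comultiplications. -/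
abbrev ComulHom (comul : R →ₗ[K] R ⊗[K] R) : Type _ :=
  {f : C →ₗ[K] R // comul ∘ₗ f = convPair f f}

variable {comul : R →ₗ[K] R ⊗[K] R} {counit : R →ₗ[K] K} {one : R} {mul : R ⊗[K] R →ₗ[K] R}

/-- A linear map `v : C → R` is tangent to `p` if `Δ ∘ v = (v ⊗ p + p ⊗ v) ∘ Δ`. -/
def IsTangent (p : ComulHom C comul) (v : C →ₗ[K] R) : Prop :=
  comul ∘ₗ v = convPair v p.1 + convPair p.1 v

/-- Left convolution action `a ↦ x ▹ a`. -/
noncomputable def convLeft (mul : R ⊗[K] R →ₗ[K] R) (x : ComulHom C comul) :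
    (C →ₗ[K] R) →ₗ[K] (C →ₗ[K] R) where
  toFun a := mul ∘ₗ convPair x.1 a
  map_add' a b := by rw [convPair_add_right, LinearMap.comp_add]
  map_smul' k a := by rw [convPair_smul_right, LinearMap.comp_smul]; rfl

/-- Right convolution action `a ↦ a ▹ x`. -/
noncomputable def convRight (mul : R ⊗[K] R →ₗ[K] R) (x : ComulHom C comul) :
    (C →ₗ[K] R) →ₗ[K] (C →ₗ[K] R) where
  toFun a := mul ∘ₗ convPair a x.1
  map_add' a b := by rw [convPair_add_left, LinearMap.comp_add]
  map_smul' k a := by rw [convPair_smul_left, LinearMap.comp_smul]; rfl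

lemma convLeft_apply (x : ComulHom C comul) (a : C →ₗ[K] R) :
    convLeft mul x a = mul ∘ₗ convPair x.1 a := rfl

lemma convRight_apply (x : ComulHom C comul) (a : C →ₗ[K] R) :
    convRight mul x a = mul ∘ₗ convPair a x.1 := rfl

lemma IsRackBialgebra.comul_mul_convPair (hR : IsRackBialgebra K R comul counit one mul)
    (f g : C →ₗ[K] R) :
    comul ∘ₗ mul ∘ₗ convPair f g = TensorProduct.map mul mul ∘ₗ
      (tensorTensorTensorComm K R R R R).toLinearMap ∘ₗ convPair (comul ∘ₗ f) (comul ∘ₗ g) := by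
  rw [← LinearMap.comp_assoc, hR.comul_mul, comul2, ← map_comp_convPair]
  simp only [LinearMap.comp_assoc]

lemma IsRackBialgebra.self_distrib_convPair (hR : IsRackBialgebra K R comul counit one mul)
    (x a b : C →ₗ[K] R) :
    mul ∘ₗ convPair x (mul ∘ₗ convPair a b) = mul ∘ₗ TensorProduct.map mul mul ∘ₗ
      (tensorTensorTensorComm K R R R R).toLinearMap ∘ₗ
        convPair (comul ∘ₗ x) (convPair a b) := by
  rw [← LinearMap.id_comp x, ← map_comp_convPair, ← LinearMap.comp_assoc, hR.self_distrib,
    LinearMap.id_comp, ← LinearMap.id_comp (convPair a b), ← map_comp_convPair]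
  simp only [LinearMap.comp_assoc, LinearMap.id_comp]

/-- The maps `C → R` compatible with comultiplication form a shelf under convolution. -/
noncomputable abbrev IsRackBialgebra.comulHomShelf [Coalgebra.IsCocomm K C]
    (hR : IsRackBialgebra K R comul counit one mul) : Shelf (ComulHom C comul) where
  act x y := ⟨convLeft mul x y.1, by
    rw [convLeft_apply, hR.comul_mul_convPair, x.2, y.2, tensorTensorTensorComm_convPair,
      map_comp_convPair]⟩
  self_distrib {x y z} := Subtype.ext <| by
    simp only [convLeft_apply, hR.self_distrib_convPair, x.2, tensorTensorTensorComm_convPair,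
      map_comp_convPair]

lemma IsTangent.add {p : ComulHom C comul} {v w : C →ₗ[K] R} (hv : IsTangent p v)
    (hw : IsTangent p w) : IsTangent p (v + w) := by
  rw [IsTangent] at *
  rw [LinearMap.comp_add, hv, hw, convPair_add_left, convPair_add_right]
  abel

lemma IsTangent.smul (k : K) {p : ComulHom C comul} {v : C →ₗ[K] R} (hv : IsTangent p v) :
    IsTangent p (k • v) := by
  rw [IsTangent] at *
  rw [LinearMap.comp_smul, hv, convPair_smul_left, convPair_smul_right, smul_add]

variable (K R)

/-- The map `c ↦ Σ f₀(c⁽¹⁾) ⊗ ⋯ ⊗ fₙ(c⁽ⁿ⁺¹⁾)`. -/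
noncomputable def convTuple : (n : ℕ) → (ℕ → ComulHom C comul) → C →ₗ[K] Tpow K R n
  | 0, f => (f 0).1
  | n + 1, f => convPair (f 0).1 (convTuple n fun i => f (i + 1))

variable {K R}

lemma convTuple_congr {n : ℕ} {f g : ℕ → ComulHom C comul} (h : ∀ i ≤ n, f i = g i) :
    convTuple K R n f = convTuple K R n g := by
  induction n generalizing f g with
  | zero => simp only [convTuple]; rw [h 0 le_rfl]
  | succ n ih =>
    simp only [convTuple]
    rw [h 0 (by omega), ih fun i hi => h (i + 1) (by omega)]

lemma tcast_convTuple {m m' : ℕ} (h : m = m') (f : ℕ → ComulHom C comul) :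
    tcast K R h ∘ₗ convTuple K R m f = convTuple K R m' f := by
  subst h; rfl

lemma deltaL_convTuple [Coalgebra.IsCocomm K C] (n : ℕ) (f : ℕ → ComulHom C comul) :
    deltaL K R comul n ∘ₗ convTuple K R n f
      = convPair (convTuple K R n f) (convTuple K R n f) := by
  induction n generalizing f with
  | zero => exact (f 0).2
  | succ n ih => exact shuffle_convPair (f 0).2 (ih _)

lemma Dsplit_convTuple [Coalgebra.IsCocomm K C] (s j : ℕ) (f : ℕ → ComulHom C comul) :
    Dsplit K R comul s j ∘ₗ convTuple K R ((s + 1) + j) f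
      = convPair (convTuple K R j f) (convTuple K R (s + j) (skip j f)) := by
  induction j generalizing f with
  | zero => rfl
  | succ j ih =>
    refine (shuffle_convPair (f 0).2 (ih fun i => f (i + 1))).trans ?_
    rw [← skip_succ_tail]
    rfl

section Shelf

variable [Shelf (ComulHom C comul)]

lemma muL_convTuple (hact : ∀ x y : ComulHom C comul, (x ◃ y).1 = convLeft mul x y.1)
    (n : ℕ) (f : ℕ → ComulHom C comul) :
    muL K R mul n ∘ₗ convTuple K R n f = (shelfProd n f).1 := by
  induction n generalizing f with
  | zero => rfl
  | succ n ih =>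
    rw [shelfProd, hact, ← ih]
    exact congrArg (mul ∘ₗ ·) (map_comp_convPair _ _ _ _)

variable [Coalgebra.IsCocomm K C]

lemma IsTangent.lact (hR : IsRackBialgebra K R comul counit one mul)
    (hact : ∀ x y : ComulHom C comul, (x ◃ y).1 = convLeft mul x y.1)
    (x : ComulHom C comul) {p : ComulHom C comul} {v : C →ₗ[K] R} (hv : IsTangent p v) :
    IsTangent (x ◃ p) (convLeft mul x v) := by
  rw [IsTangent] at hv ⊢
  rw [convLeft_apply, hR.comul_mul_convPair, hv, x.2, convPair_add_right]
  simp only [LinearMap.comp_add, tensorTensorTensorComm_convPair, map_comp_convPair, hact,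
    convLeft_apply]

lemma IsTangent.ract (hR : IsRackBialgebra K R comul counit one mul)
    (hact : ∀ x y : ComulHom C comul, (x ◃ y).1 = convLeft mul x y.1)
    (x : ComulHom C comul) {p : ComulHom C comul} {v : C →ₗ[K] R} (hv : IsTangent p v) :
    IsTangent (p ◃ x) (convRight mul x v) := by
  rw [IsTangent] at hv ⊢
  rw [convRight_apply, hR.comul_mul_convPair, hv, x.2, convPair_add_left]
  simp only [LinearMap.comp_add, tensorTensorTensorComm_convPair, map_comp_convPair, hact,
    convLeft_apply]

lemma IsRackBialgebra.isShelfModule (hR : IsRackBialgebra K R comul counit one mul)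
    (hact : ∀ x y : ComulHom C comul, (x ◃ y).1 = convLeft mul x y.1) :
    IsShelfModule (convLeft (C := C) (comul := comul) mul) (convRight mul)
      IsTangent where
  lact_lact x y a := by
    simp only [convLeft_apply, hR.self_distrib_convPair, x.2, tensorTensorTensorComm_convPair,
      map_comp_convPair, hact]
  lact_ract x y a := by
    simp only [convLeft_apply, convRight_apply, hR.self_distrib_convPair, x.2,
      tensorTensorTensorComm_convPair, map_comp_convPair, hact]
  ract_act p x y a ha := by
    rw [IsTangent] at ha
    simp only [convLeft_apply, convRight_apply, hR.self_distrib_convPair, ha, convPair_add_left,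
      LinearMap.comp_add, tensorTensorTensorComm_convPair, map_comp_convPair, hact]

lemma Amap_convTuple (hact : ∀ x y : ComulHom C comul, (x ◃ y).1 = convLeft mul x y.1)
    (p : ℕ) (x : ComulHom C comul) (f : ℕ → ComulHom C comul) :
    Amap K R comul mul p ∘ₗ convPair x.1 (convTuple K R p f)
      = convTuple K R p fun i => x ◃ f i := by
  induction p generalizing f with
  | zero => exact (hact _ _).symm
  | succ p ih =>
    refine (congrArg (TensorProduct.map mul (Amap K R comul mul p) ∘ₗ ·)
      (shuffle_convPair x.2 (LinearMap.id_comp _))).trans ?_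
    refine (map_comp_convPair _ _ _ _).trans ?_
    rw [ih]
    exact congrArg (convPair · _) (hact _ _).symm

lemma Gmap_convTuple (hact : ∀ x y : ComulHom C comul, (x ◃ y).1 = convLeft mul x y.1)
    (p j : ℕ) (f : ℕ → ComulHom C comul) :
    Gmap K R comul mul p j ∘ₗ convTuple K R ((p + 1) + j) f
      = convTuple K R (p + j) (actTail j f) := by
  induction j generalizing f with
  | zero => exact Amap_convTuple hact p (f 0) fun i => f (i + 1)
  | succ j ih =>
    refine (map_comp_convPair _ _ _ _).trans ?_
    refine congrArg (convPair (f 0).1) ((ih fun i => f (i + 1)).trans ?_)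
    rw [← actTail_succ_tail]
    rfl

lemma dOne_convTuple (hact : ∀ x y : ComulHom C comul, (x ◃ y).1 = convLeft mul x y.1)
    {m j : ℕ} (hj : j ≤ m) (ω : Tpow K R m →ₗ[K] R) :
    (fun f : ℕ → ComulHom C comul => dOne K R comul mul m j hj ω ∘ₗ convTuple K R (m + 1) f)
      = faceOne (convLeft mul) j fun f => ω ∘ₗ convTuple K R m f := by
  funext f
  simp only [dOne, faceOne, LinearMap.comp_assoc, tcast_convTuple, Dsplit_convTuple,
    map_comp_convPair, muL_convTuple hact, LinearMap.coe_mk, AddHom.coe_mk, convLeft_apply]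

lemma dZero_convTuple (hact : ∀ x y : ComulHom C comul, (x ◃ y).1 = convLeft mul x y.1)
    {m j : ℕ} (hj : j ≤ m) (ω : Tpow K R m →ₗ[K] R) :
    (fun f : ℕ → ComulHom C comul => dZero K R comul mul m j hj ω ∘ₗ convTuple K R (m + 1) f)
      = faceZero K (C →ₗ[K] R) j fun f => ω ∘ₗ convTuple K R m f := by
  funext f
  simp only [dZero, faceZero, LinearMap.comp_assoc, tcast_convTuple, Gmap_convTuple hact,
    LinearMap.coe_mk, AddHom.coe_mk]

lemma dLast_convTuple (hact : ∀ x y : ComulHom C comul, (x ◃ y).1 = convLeft mul x y.1)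
    (m : ℕ) (ω : Tpow K R m →ₗ[K] R) :
    (fun f : ℕ → ComulHom C comul => dLast K R comul mul m ω ∘ₗ convTuple K R (m + 1) f)
      = faceLast (convRight mul) m fun f => ω ∘ₗ convTuple K R m f := by
  funext f
  simp only [dLast, faceLast, LinearMap.comp_assoc, tcast_convTuple, Dsplit_convTuple,
    map_comp_convPair, muL_convTuple hact, LinearMap.coe_mk, AddHom.coe_mk, convRight_apply]

lemma dDef_convTuple (hact : ∀ x y : ComulHom C comul, (x ◃ y).1 = convLeft mul x y.1)
    (m : ℕ) (ω : Tpow K R m →ₗ[K] R) :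
    (fun f : ℕ → ComulHom C comul => dDef K R comul mul m ω ∘ₗ convTuple K R (m + 1) f)
      = shelfDiff (convLeft mul) (convRight mul) m fun f => ω ∘ₗ convTuple K R m f := by
  rw [shelfDiff, ← Fin.sum_univ_eq_sum_range]
  simp only [LinearMap.add_apply, LinearMap.sum_apply, LinearMap.smul_apply, faceDiff,
    LinearMap.sub_apply, ← dLast_convTuple hact]
  funext f
  simp only [dDef, Pi.add_apply, Finset.sum_apply, Pi.smul_apply, Pi.sub_apply,
    LinearMap.add_comp, LinearMap.smul_comp]
  congr 1
  refine (map_sum (LinearMap.lcomp K R (convTuple K R (m + 1) f)) _ _).trans ?_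
  refine Finset.sum_congr rfl fun j _ => ?_
  rw [← dOne_convTuple hact (Nat.lt_succ_iff.mp j.isLt),
    ← dZero_convTuple hact (Nat.lt_succ_iff.mp j.isLt), map_smul, map_sub]
  rfl

lemma IsCoderivation.isTangent
    (hact : ∀ x y : ComulHom C comul, (x ◃ y).1 = convLeft mul x y.1)
    {m : ℕ} {ω : Tpow K R m →ₗ[K] R} (hω : IsCoderivation K R comul mul m ω)
    (f : ℕ → ComulHom C comul) : IsTangent (shelfProd m f) (ω ∘ₗ convTuple K R m f) := by
  rw [IsCoderivation] at hω
  rw [IsTangent, ← LinearMap.comp_assoc, hω, LinearMap.comp_assoc, deltaL_convTuple,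
    LinearMap.add_comp, map_comp_convPair, map_comp_convPair, muL_convTuple hact]

end Shelf

end Convolution

section Projections

variable {K}

section Factors

variable {C D : Type*} [AddCommGroup C] [Module K C] [Coalgebra K C]
  [AddCommGroup D] [Module K D] [Coalgebra K D]
  {M N : Type*} [AddCommGroup M] [Module K M] [AddCommGroup N] [Module K N]

variable (K C D) in
/-- The projection of a tensor product of coalgebras to its first factor. -/
noncomputable def coalgFst : C ⊗[K] D →ₗc[K] C :=
  (Coalgebra.TensorProduct.rid K K C : C ⊗[K] K →ₗc[K] C).comp
    (Coalgebra.TensorProduct.map (CoalgHom.id K C) (Coalgebra.counitCoalgHom K D))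

variable (K C D) in
/-- The projection of a tensor product of coalgebras to its second factor. -/
noncomputable def coalgSnd : C ⊗[K] D →ₗc[K] D :=
  (Coalgebra.TensorProduct.lid K D : K ⊗[K] D →ₗc[K] D).comp
    (Coalgebra.TensorProduct.map (Coalgebra.counitCoalgHom K C) (CoalgHom.id K D))

lemma convPair_fst_snd :
    convPair (coalgFst K C D).toLinearMap (coalgSnd K C D).toLinearMap = LinearMap.id := by
  have hnat : TensorProduct.map (coalgFst K C D).toLinearMap (coalgSnd K C D).toLinearMap ∘ₗ
      (tensorTensorTensorComm K C C D D).toLinearMap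
      = TensorProduct.map
          ((TensorProduct.rid K C).toLinearMap ∘ₗ Coalgebra.counit.lTensor C)
          ((TensorProduct.lid K D).toLinearMap ∘ₗ Coalgebra.counit.rTensor D) := by
    ext c c' d d'
    simp [coalgFst, coalgSnd, TensorProduct.smul_tmul', TensorProduct.tmul_smul, smul_smul,
      mul_comm]
  have hdef : (Coalgebra.comul : C ⊗[K] D →ₗ[K] _)
      = (tensorTensorTensorComm K C C D D).toLinearMap ∘ₗ
        TensorProduct.map Coalgebra.comul Coalgebra.comul := rfl
  rw [convPair, hdef, ← LinearMap.comp_assoc, hnat, ← TensorProduct.map_comp]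
  ext c d
  simp

lemma convPair_comp (f : D →ₗ[K] M) (g : D →ₗ[K] N) (p : C →ₗc[K] D) :
    convPair f g ∘ₗ p.toLinearMap = convPair (f ∘ₗ p.toLinearMap) (g ∘ₗ p.toLinearMap) := by
  rw [convPair, LinearMap.comp_assoc, ← p.map_comp_comul, ← LinearMap.comp_assoc,
    ← TensorProduct.map_comp]
  rfl

variable {R : Type*} [AddCommGroup R] [Module K R] {comul : R →ₗ[K] R ⊗[K] R}

/-- Precomposition with a coalgebra morphism. -/
noncomputable def ComulHom.comp (x : ComulHom D comul) (p : C →ₗc[K] D) : ComulHom C comul :=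
  ⟨x.1 ∘ₗ p.toLinearMap, by rw [← LinearMap.comp_assoc, x.2, convPair_comp]⟩

lemma convTuple_comp (n : ℕ) (f : ℕ → ComulHom D comul) (p : C →ₗc[K] D) :
    convTuple K R n (fun i => ComulHom.comp (f i) p) = convTuple K R n f ∘ₗ p.toLinearMap := by
  induction n generalizing f with
  | zero => rfl
  | succ n ih =>
    refine (congrArg (convPair _) (ih fun i => f (i + 1))).trans ?_
    exact (convPair_comp _ _ p).symm

end Factors

variable {R : Type*} [AddCommGroup R] [Module K R] [Coalgebra K R]

/-- The tensor-product coalgebra structure on `R^{⊗(n+1)}`. -/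
noncomputable instance tpowCoalgebra : (n : ℕ) → Coalgebra K (Tpow K R n)
  | 0 => (inferInstance : Coalgebra K R)
  | n + 1 =>
    letI := tpowCoalgebra n
    (inferInstance : Coalgebra K (R ⊗[K] Tpow K R n))

instance tpow_isCocomm [Coalgebra.IsCocomm K R] :
    (n : ℕ) → Coalgebra.IsCocomm K (Tpow K R n)
  | 0 => (inferInstance : Coalgebra.IsCocomm K R)
  | n + 1 =>
    letI := tpow_isCocomm n
    (inferInstance : Coalgebra.IsCocomm K (R ⊗[K] Tpow K R n))

lemma tpow_comul (n : ℕ) :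
    (Coalgebra.comul : Tpow K R n →ₗ[K] _) = deltaL K R Coalgebra.comul n := by
  induction n with
  | zero => rfl
  | succ n ih =>
    rw [deltaL, ← ih]
    rfl

variable (K R) in
/-- The projections `R^{⊗(n+1)} → R`; those of index larger than `n` equal the last one. -/
noncomputable def tpowProj : (n : ℕ) → ℕ → ComulHom (K := K) (Tpow K R n) (R := R) Coalgebra.comul
  | 0, _ => ⟨LinearMap.id, by
      exact (congrArg (· ∘ₗ Coalgebra.comul) TensorProduct.map_id).symm⟩
  | n + 1, 0 => ⟨(coalgFst K R (Tpow K R n)).toLinearMap,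
      (coalgFst K R (Tpow K R n)).map_comp_comul.symm⟩
  | n + 1, i + 1 => (ComulHom.comp (tpowProj n i) (coalgSnd K R (Tpow K R n)) :)

lemma convTuple_tpowProj (n : ℕ) : convTuple K R n (tpowProj K R n) = LinearMap.id := by
  induction n with
  | zero => rfl
  | succ n ih =>
    have h := convTuple_comp n (tpowProj K R n) (coalgSnd K R (Tpow K R n))
    rw [ih, LinearMap.id_comp] at h
    exact (congrArg (convPair (coalgFst K R (Tpow K R n)).toLinearMap) h).trans convPair_fst_snd

lemma eq_zero_of_comp_convTuple {n : ℕ} {Φ : Tpow K R n →ₗ[K] R}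
    (h : Φ ∘ₗ convTuple K R n (tpowProj K R n) = 0) : Φ = 0 := by
  rwa [convTuple_tpowProj, LinearMap.comp_id] at h

lemma isCoderivation_of_isTangent {mul : R ⊗[K] R →ₗ[K] R} {n : ℕ}
    [Shelf (ComulHom (Tpow K R n) (Coalgebra.comul (R := K) (A := R)))]
    (hact : ∀ x y : ComulHom (Tpow K R n) (Coalgebra.comul (R := K) (A := R)),
      (Shelf.act x y).1 = convLeft mul x y.1) {Φ : Tpow K R n →ₗ[K] R}
    (h : IsTangent (shelfProd n (tpowProj K R n)) (Φ ∘ₗ convTuple K R n (tpowProj K R n))) :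
    IsCoderivation K R Coalgebra.comul mul n Φ := by
  rw [IsTangent, ← muL_convTuple hact, convTuple_tpowProj, LinearMap.comp_id,
    LinearMap.comp_id] at h
  rw [IsCoderivation, h, LinearMap.add_comp, ← tpow_comul]
  rfl

end Projections

/-- The coalgebra structure given by the data of a C³-coalgebra. -/
noncomputable abbrev IsC3Coalgebra.toCoalgebra {K : Type*} [CommRing K] {B : Type*} [AddCommGroup B]
    [Module K B] {comul : B →ₗ[K] B ⊗[K] B} {counit : B →ₗ[K] K} {one : B}
    (h : IsC3Coalgebra K B comul counit one) : Coalgebra K B where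
  comul := comul
  counit := counit
  coassoc := h.coassoc
  rTensor_counit_comp_comul := by
    ext x
    apply (TensorProduct.lid K B).injective
    exact (LinearMap.congr_fun h.counit_comul x).trans (by simp)
  lTensor_counit_comp_comul := by
    ext x
    apply (TensorProduct.rid K B).injective
    exact (LinearMap.congr_fun h.comul_counit x).trans (by simp)

/-- The module `Cⁿ⁺¹(R;R)` of coderivations along the iterated product. -/
def coderivationSubmodule {K : Type*} [CommRing K] {R : Type*} [AddCommGroup R] [Module K R]
    (comul : R →ₗ[K] R ⊗[K] R) (mul : R ⊗[K] R →ₗ[K] R) (n : ℕ) :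
    Submodule K (Tpow K R n →ₗ[K] R) where
  carrier := {ω | IsCoderivation K R comul mul n ω}
  zero_mem' := by
    simp only [Set.mem_ofPred_eq, IsCoderivation, LinearMap.comp_zero, TensorProduct.map_zero_left,
      TensorProduct.map_zero_right, add_zero, LinearMap.zero_comp]
  add_mem' {ω η} hω hη := by
    simp only [Set.mem_ofPred_eq, IsCoderivation, LinearMap.comp_add, LinearMap.add_comp,
      TensorProduct.map_add_left, TensorProduct.map_add_right] at hω hη ⊢
    rw [hω, hη]
    abel
  smul_mem' k ω hω := by
    simp only [Set.mem_ofPred_eq, IsCoderivation, LinearMap.comp_smul,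
      TensorProduct.map_smul_left, TensorProduct.map_smul_right] at hω ⊢
    rw [hω, ← smul_add, LinearMap.smul_comp]

/-- Let `(R, Δ, ε, 1, ▹)` be a cocommutative rack bialgebra over `K`.
Then each of the maps `d_{i,1}`, `d_{i,0}` (`1 ≤ i ≤ n`) and `d_{n+1}` sends the space
`Cⁿ(R;R)` of coderivations along `μⁿ` into `Cⁿ⁺¹(R;R)`, and the differential
`d_Rⁿ = Σ_{i=1}^{n} (−1)^{i+1}(d_{i,1} − d_{i,0}) + (−1)^{n+1} d_{n+1}` satisfies
`d_R^{n+1} ∘ d_Rⁿ = 0` on coderivations; hence `(C*(R;R), d_R)` is a cochain complex. -/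
theorem deformation_complex_is_complex
    (K : Type*) [CommRing K] [Algebra ℚ K]
    (R : Type*) [AddCommGroup R] [Module K R]
    (comul : R →ₗ[K] R ⊗[K] R) (counit : R →ₗ[K] K) (one : R) (mul : R ⊗[K] R →ₗ[K] R)
    (hR : IsRackBialgebra K R comul counit one mul)
    (cocomm : ∀ x : R, (TensorProduct.comm K R R) (comul x) = comul x) :
    ∀ (m : ℕ) (ω : Tpow K R m →ₗ[K] R), IsCoderivation K R comul mul m ω →
      (∀ (j : ℕ) (hj : j ≤ m),
        IsCoderivation K R comul mul (m + 1) (dOne K R comul mul m j hj ω) ∧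
        IsCoderivation K R comul mul (m + 1) (dZero K R comul mul m j hj ω)) ∧
      IsCoderivation K R comul mul (m + 1) (dLast K R comul mul m ω) ∧
      IsCoderivation K R comul mul (m + 1) (dDef K R comul mul m ω) ∧
      dDef K R comul mul (m + 1) (dDef K R comul mul m ω) = 0 := by
  let _ := hR.isC3.toCoalgebra
  have : Coalgebra.IsCocomm K R := ⟨LinearMap.ext cocomm⟩
  intro m ω hω
  let _ : Shelf (ComulHom (Tpow K R (m + 1)) comul) := hR.comulHomShelf
  have hact : ∀ x y : ComulHom (Tpow K R (m + 1)) comul,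
      (Shelf.act x y).1 = convLeft mul x y.1 := fun _ _ => rfl
  have htan := hω.isTangent hact
  have hone : ∀ (j : ℕ) (hj : j ≤ m),
      IsCoderivation K R comul mul (m + 1) (dOne K R comul mul m j hj ω) := by
    intro j hj
    refine isCoderivation_of_isTangent hact ?_
    refine (congrArg (IsTangent _) (congrFun (dOne_convTuple hact hj ω) _)).mpr ?_
    rw [← shelfProd_act_skip hj]
    exact (htan _).lact hR hact _
  have hzero : ∀ (j : ℕ) (hj : j ≤ m),
      IsCoderivation K R comul mul (m + 1) (dZero K R comul mul m j hj ω) := by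
    intro j hj
    refine isCoderivation_of_isTangent hact ?_
    refine (congrArg (IsTangent _) (congrFun (dZero_convTuple hact hj ω) _)).mpr ?_
    rw [← shelfProd_actTail hj]
    exact htan _
  have hlast : IsCoderivation K R comul mul (m + 1) (dLast K R comul mul m ω) := by
    refine isCoderivation_of_isTangent hact ?_
    refine (congrArg (IsTangent _) (congrFun (dLast_convTuple hact m ω) _)).mpr ?_
    rw [← shelfProd_act_skip le_rfl]
    exact (htan _).ract hR hact _
  refine ⟨fun j hj => ⟨hone j hj, hzero j hj⟩, hlast, ?_, ?_⟩
  · exact Submodule.add_mem (coderivationSubmodule comul mul (m + 1))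
      (Submodule.sum_mem _ fun j _ => Submodule.smul_mem _ _
        (Submodule.sub_mem _ (hone _ _) (hzero _ _)))
      (Submodule.smul_mem _ _ hlast)
  · let _ : Shelf (ComulHom (Tpow K R (m + 2)) comul) := hR.comulHomShelf
    have hact₂ : ∀ x y : ComulHom (Tpow K R (m + 2)) comul,
        (Shelf.act x y).1 = convLeft mul x y.1 := fun _ _ => rfl
    refine eq_zero_of_comp_convTuple ?_
    refine (congrFun (dDef_convTuple hact₂ (m + 1) _) _).trans ?_
    rw [dDef_convTuple hact₂ m ω, shelfDiff_shelfDiff (hR.isShelfModule hact₂)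
      (hω.isTangent hact₂) fun f g h => by rw [convTuple_congr h]]
    rfl

end RackPaper
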